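/- For a radius a' > 0, wave number k > 0, and density w(y) = Y_l^p(ŷ) a spherical harmonic on the sphere ∂B_{a'}(0), the single layer potential ∫_{∂B_{a'}} w(y) Φ(x,y) dS_y, where Φ(x,y) = e^{ik|x−y|}/(4π|x−y|) is the fundamental solution of the Helmholtz equation, equals i k a'^2 j_l(k a') h_l^{(1)}(k|x|) Y_l^p(x̂) for all x with |x| > a', where j_l is the spherical Bessel function and h_l^{(1)} the spherical Hankel function of the first kind. -/

import Mathlib

open MeasureTheory Metric Filter Topology

noncomputable section

abbrev E3 := EuclideanSpace ℝ (Fin 3)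

/-- The outgoing fundamental solution of the Helmholtz equation in ℝ³. -/
def Phi (k : ℝ) (x y : E3) : ℂ :=
  Complex.exp (Complex.I * k * ‖x - y‖) / (4 * Real.pi * ‖x - y‖)

/-- Spherical Bessel function of the first kind, via the standard recurrence. -/
def sphericalBesselJ : ℕ → ℝ → ℝ
  | 0, t => Real.sin t / t
  | 1, t => Real.sin t / t ^ 2 - Real.cos t / t
  | (n + 2), t => (2 * (n : ℝ) + 3) / t * sphericalBesselJ (n + 1) t - sphericalBesselJ n t

/-- Spherical Bessel function of the second kind, via the standard recurrence. -/
def sphericalBesselY : ℕ → ℝ → ℝ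
  | 0, t => -(Real.cos t / t)
  | 1, t => -(Real.cos t / t ^ 2) - Real.sin t / t
  | (n + 2), t => (2 * (n : ℝ) + 3) / t * sphericalBesselY (n + 1) t - sphericalBesselY n t

/-- Spherical Hankel function of the first kind. -/
def sphericalHankel (l : ℕ) (t : ℝ) : ℂ :=
  (sphericalBesselJ l t : ℂ) + Complex.I * (sphericalBesselY l t : ℂ)

/-- The Laplacian of a function on ℝ³, as the sum of second directional derivatives. -/
def laplacian (u : E3 → ℂ) (x : E3) : ℂ :=
  ∑ i : Fin 3, fderiv ℝ (fun y => fderiv ℝ u y (EuclideanSpace.single i 1)) x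
    (EuclideanSpace.single i 1)

/-- The Sommerfeld radiation condition: `x̂·∇u(x) − i k u(x) = o(1/|x|)` uniformly. -/
def SommerfeldRadiation (k : ℝ) (u : E3 → ℂ) : Prop :=
  ∀ ε > 0, ∃ R : ℝ, ∀ x : E3, R ≤ ‖x‖ →
    ‖x‖ * ‖fderiv ℝ u x (‖x‖⁻¹ • x) - Complex.I * k * u x‖ ≤ ε

/-- `Y` is (the restriction to directions of) a spherical harmonic of degree `l`:
the restriction to the unit sphere of a harmonic homogeneous polynomial of degree `l`. -/
def IsSphericalHarmonic (l : ℕ) (Y : E3 → ℂ) : Prop :=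
  ∃ P : MvPolynomial (Fin 3) ℂ, P.IsHomogeneous l ∧
    (∀ x : E3, laplacian (fun z => MvPolynomial.eval (fun i => (z i : ℂ)) P) x = 0) ∧
    ∀ x : E3, ‖x‖ = 1 → Y x = MvPolynomial.eval (fun i => (x i : ℂ)) P

/-- The surface measure on the unit sphere in ℝ³. -/
def sphereMeasure : Measure (sphere (0 : E3) 1) := (volume : Measure E3).toSphere

/-- Surface integral over the sphere of radius `a` centered at the origin. -/
def sphereIntegral (a : ℝ) (f : E3 → ℂ) : ℂ :=
  a ^ 2 • ∫ ω : sphere (0 : E3) 1, f (a • (ω : E3)) ∂sphereMeasure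

/-- An orthonormal family of spherical harmonics `Y l p`, `|p| ≤ l`. -/
def IsOrthonormalSphericalHarmonics (Y : ℕ → ℤ → E3 → ℂ) : Prop :=
  (∀ l : ℕ, ∀ p : ℤ, |p| ≤ l → IsSphericalHarmonic l (Y l p)) ∧
  ∀ l l' : ℕ, ∀ p p' : ℤ, |p| ≤ l → |p'| ≤ l' →
    (∫ ω : sphere (0 : E3) 1, Y l p ω * (starRingEnd ℂ) (Y l' p' ω) ∂sphereMeasure) =
      if l = l' ∧ p = p' then 1 else 0

/-- The normal derivative `∂Φ(x,y)/∂n_y` on the sphere of radius `a`, at `y = a ω`. -/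
def dPhidn (k : ℝ) (x : E3) (y : E3) : ℂ :=
  fderiv ℝ (fun z => Phi k x z) y (‖y‖⁻¹ • y)

/-- The double layer potential of a density `w` (given on directions) on `∂B_a(0)`. -/
def dlPotential (k a : ℝ) (w : E3 → ℂ) (x : E3) : ℂ :=
  sphereIntegral a (fun y => w (‖y‖⁻¹ • y) * dPhidn k x y)

/-- The single layer potential of a density `w` on `∂B_a(0)`. -/
def slPotential (k a : ℝ) (w : E3 → ℂ) (x : E3) : ℂ :=
  sphereIntegral a (fun y => w (‖y‖⁻¹ • y) * Phi k x y)

end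

noncomputable section

section SphereMeasure

variable {E : Type*} [NormedAddCommGroup E] [NormedSpace ℝ E] [MeasurableSpace E] [BorelSpace E]

open Pointwise in
/-- A measure-preserving linear isometry induces a measure-preserving map of the unit sphere. -/
theorem integral_toSphere_comp_linearIsometryEquiv {μ : Measure E} (L : E ≃ₗᵢ[ℝ] E)
    (hL : MeasurePreserving L μ μ) (f : E → ℂ) :
    ∫ ω : sphere (0 : E) 1, f (L ω) ∂μ.toSphere = ∫ ω : sphere (0 : E) 1, f ω ∂μ.toSphere := by
  have hT : ∀ x, x ∈ sphere (0 : E) 1 ↔ L x ∈ sphere (0 : E) 1 := by simp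
  let T : sphere (0 : E) 1 ≃ₜ sphere (0 : E) 1 := L.toHomeomorph.subtype hT
  have hmp : MeasurePreserving T μ.toSphere μ.toSphere := by
    refine ⟨T.continuous.measurable, ?_⟩
    ext s hs
    rw [Measure.map_apply T.continuous.measurable hs,
      Measure.toSphere_apply' _ (T.continuous.measurable hs), Measure.toSphere_apply' _ hs]
    congr 1
    rw [← hL.measure_preimage_emb L.toHomeomorph.measurableEmbedding
      (Set.Ioo (0 : ℝ) 1 • (Subtype.val '' s))]
    congr 1
    ext y
    simp only [Set.mem_smul, Set.mem_image, Set.mem_preimage]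
    constructor
    · rintro ⟨r, hr, _, ⟨w, hw, rfl⟩, rfl⟩
      exact ⟨r, hr, _, ⟨T w, hw, rfl⟩, (map_smul L r (w : E)).symm⟩
    · rintro ⟨r, hr, _, ⟨w, hw, rfl⟩, h⟩
      refine ⟨r, hr, _, ⟨T.symm w, by simpa using hw, rfl⟩, ?_⟩
      apply L.injective
      rw [← h, map_smul]
      congr 1
      exact congrArg Subtype.val (T.apply_symm_apply w)
  exact hmp.integral_comp T.measurableEmbedding (fun ω => f ω)

end SphereMeasure

/-- Differentiation under the integral sign for a family that is jointly `C¹` over a compact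
space. -/
theorem hasDerivAt_integral_of_compactSpace {K : Type*} [TopologicalSpace K] [CompactSpace K]
    [MeasurableSpace K] [OpensMeasurableSpace K] {μ : Measure K} [IsFiniteMeasure μ]
    {F F' : ℝ → K → ℂ} {s : Set ℝ} {a : ℝ} (hs : s ∈ 𝓝 a)
    (hF : ∀ t ∈ s, ∀ ω, HasDerivAt (fun t => F t ω) (F' t ω) t)
    (hFc : ∀ t ∈ s, Continuous (F t)) (hF' : ContinuousOn (Function.uncurry F') (s ×ˢ Set.univ)) :
    HasDerivAt (fun t => ∫ ω, F t ω ∂μ) (∫ ω, F' a ω ∂μ) a := by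
  obtain ⟨ε, hε, hball⟩ := Metric.nhds_basis_closedBall.mem_iff.1 hs
  have hcpt : IsCompact (closedBall a ε ×ˢ (Set.univ : Set K)) :=
    (isCompact_closedBall a ε).prod isCompact_univ
  obtain ⟨C, hC⟩ := hcpt.exists_bound_of_continuousOn
    (hF'.mono (Set.prod_mono hball subset_rfl))
  have hInt : ∀ g : K → ℂ, Continuous g → Integrable g μ := fun g hg =>
    (hg.integrable_of_hasCompactSupport (HasCompactSupport.of_compactSpace g))
  have ha : a ∈ s := mem_of_mem_nhds hs
  have hF'a : Continuous (F' a) := by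
    rw [← continuousOn_univ]
    exact hF'.comp (f := fun ω => (a, ω)) (by fun_prop) fun ω _ => ⟨ha, Set.mem_univ _⟩
  refine (hasDerivAt_integral_of_dominated_loc_of_deriv_le (bound := fun _ => C)
    (closedBall_mem_nhds a hε) ?_ (hInt _ (hFc a ha)) (hInt _ hF'a).aestronglyMeasurable
    ?_ (integrable_const C) ?_).2
  · filter_upwards [hs] with t ht using (hInt _ (hFc t ht)).aestronglyMeasurable
  · exact .of_forall fun ω t ht => hC (t, ω) ⟨ht, Set.mem_univ _⟩
  · exact .of_forall fun ω t ht => hF t (hball ht) ω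

/-- The rotation by the angle `θ` in the plane spanned by the `i`-th and `j`-th axes. -/
def planeRotation (i j : Fin 3) (θ : ℝ) (y : E3) : E3 :=
  y + ((Real.cos θ - 1) * y i - Real.sin θ * y j) • EuclideanSpace.single i (1 : ℝ) +
    (Real.sin θ * y i + (Real.cos θ - 1) * y j) • EuclideanSpace.single j (1 : ℝ)

theorem norm_planeRotation {i j : Fin 3} (hij : i ≠ j) (θ : ℝ) (y : E3) :
    ‖planeRotation i j θ y‖ = ‖y‖ := by
  rw [← sq_eq_sq₀ (norm_nonneg _) (norm_nonneg _), EuclideanSpace.norm_sq_eq,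
    EuclideanSpace.norm_sq_eq]
  have h := Real.sin_sq_add_cos_sq θ
  simp only [Real.norm_eq_abs, sq_abs, Fin.sum_univ_three, planeRotation]
  fin_cases i <;> fin_cases j <;> simp at hij ⊢ <;> grind

/-- `planeRotation` as a linear isometry equivalence. -/
def planeRotationEquiv {i j : Fin 3} (hij : i ≠ j) (θ : ℝ) : E3 ≃ₗᵢ[ℝ] E3 :=
  LinearIsometry.toLinearIsometryEquiv
    { toFun := planeRotation i j θ
      map_add' := fun y z => by
        simp only [planeRotation, PiLp.add_apply]
        module
      map_smul' := fun c y => by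
        simp only [planeRotation, PiLp.smul_apply, smul_eq_mul, RingHom.id_apply]
        module
      norm_map' := norm_planeRotation hij θ } rfl

theorem hasDerivAt_planeRotation (i j : Fin 3) (θ : ℝ) (y : E3) :
    HasDerivAt (fun θ => planeRotation i j θ y)
      ((-Real.sin θ * y i - Real.cos θ * y j) • EuclideanSpace.single i (1 : ℝ) +
        (Real.cos θ * y i - Real.sin θ * y j) • EuclideanSpace.single j (1 : ℝ)) θ := by
  have hc := (Real.hasDerivAt_cos θ).sub_const 1
  have hs := Real.hasDerivAt_sin θ
  have h1 := ((hc.mul_const (y i)).sub (hs.mul_const (y j))).smul_const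
    (EuclideanSpace.single i (1 : ℝ))
  have h2 := ((hs.mul_const (y i)).add (hc.mul_const (y j))).smul_const
    (EuclideanSpace.single j (1 : ℝ))
  exact ((h1.const_add y).add h2).congr_deriv (by module)

instance : IsFiniteMeasure sphereMeasure :=
  inferInstanceAs (IsFiniteMeasure (volume : Measure E3).toSphere)

theorem integrable_sphereMeasure {f : sphere (0 : E3) 1 → ℂ} (hf : Continuous f) :
    Integrable f sphereMeasure :=
  hf.integrable_of_hasCompactSupport (HasCompactSupport.of_compactSpace f)

theorem continuous_fderiv_sphere {f : E3 → ℂ} (hf : ∀ y ∈ sphere (0 : E3) 1, ContDiffAt ℝ 1 f y) :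
    Continuous fun ω : sphere (0 : E3) 1 => fderiv ℝ f ω := by
  rw [continuous_iff_continuousAt]
  intro ω
  exact ((hf ω ω.2).continuousAt_fderiv one_ne_zero).comp continuous_subtype_val.continuousAt

theorem integral_fderiv_planeRotation {f : E3 → ℂ}
    (hf : ∀ y ∈ sphere (0 : E3) 1, ContDiffAt ℝ 1 f y) (i j : Fin 3) :
    ∫ ω : sphere (0 : E3) 1, fderiv ℝ f ω ((ω : E3) i • EuclideanSpace.single j (1 : ℝ) -
      (ω : E3) j • EuclideanSpace.single i (1 : ℝ)) ∂sphereMeasure = 0 := by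
  rcases eq_or_ne i j with rfl | hij
  · simp
  have hmem : ∀ (θ : ℝ) (ω : sphere (0 : E3) 1), planeRotation i j θ ω ∈ sphere (0 : E3) 1 := by
    intro θ ω
    simp [norm_planeRotation hij]
  have hcont : Continuous fun p : ℝ × sphere (0 : E3) 1 =>
      (⟨planeRotation i j p.1 p.2, hmem _ _⟩ : sphere (0 : E3) 1) := by
    refine Continuous.subtype_mk ?_ _
    unfold planeRotation
    fun_prop
  have hfc : Continuous fun ω : sphere (0 : E3) 1 => f ω := by
    rw [continuous_iff_continuousAt]
    intro ω
    exact (hf ω ω.2).continuousAt.comp continuous_subtype_val.continuousAt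
  have hderiv := hasDerivAt_integral_of_compactSpace (μ := sphereMeasure) (s := Set.univ)
    (a := 0) (F := fun θ ω => f (planeRotation i j θ ω))
    (F' := fun θ ω => fderiv ℝ f (planeRotation i j θ ω)
      ((-Real.sin θ * (ω : E3) i - Real.cos θ * (ω : E3) j) • EuclideanSpace.single i (1 : ℝ) +
        (Real.cos θ * (ω : E3) i - Real.sin θ * (ω : E3) j) • EuclideanSpace.single j (1 : ℝ)))
    univ_mem ?_ ?_ ?_
  · have hconst : (fun θ => ∫ ω : sphere (0 : E3) 1, f (planeRotation i j θ ω) ∂sphereMeasure) =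
        fun _ => ∫ ω : sphere (0 : E3) 1, f ω ∂sphereMeasure := by
      funext θ
      exact integral_toSphere_comp_linearIsometryEquiv (planeRotationEquiv hij θ)
        (planeRotationEquiv hij θ).measurePreserving f
    rw [hconst] at hderiv
    rw [← (hderiv.unique (hasDerivAt_const _ _))]
    refine integral_congr_ae (.of_forall fun ω => ?_)
    have h0 : planeRotation i j 0 ω = ω := by simp [planeRotation]
    simp only [h0, Real.sin_zero, Real.cos_zero]
    congr 1
    module
  · intro θ _ ω
    exact ((hf _ (hmem θ ω)).differentiableAt one_ne_zero).hasFDerivAt.comp_hasDerivAt θ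
      (hasDerivAt_planeRotation i j θ ω)
  · intro θ _
    exact hfc.comp (hcont.comp (by fun_prop : Continuous fun ω => (θ, ω)))
  · refine Continuous.continuousOn ?_
    refine ((continuous_fderiv_sphere hf).comp hcont).clm_apply ?_
    fun_prop

/-- The divergence theorem on the unit sphere, for the tangential part of `f • eᵢ`. -/
theorem integral_tangential_fderiv {f : E3 → ℂ}
    (hf : ∀ y ∈ sphere (0 : E3) 1, ContDiffAt ℝ 1 f y) (i : Fin 3) :
    ∫ ω : sphere (0 : E3) 1, (fderiv ℝ f ω (EuclideanSpace.single i 1) -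
      ((ω : E3) i : ℂ) * fderiv ℝ f ω ω - 2 * ((ω : E3) i : ℂ) * f ω) ∂sphereMeasure = 0 := by
  have hcoord : ∀ (j : Fin 3) (y : E3), HasFDerivAt (fun y : E3 => ((y j : ℝ) : ℂ))
      (Complex.ofRealCLM.comp (EuclideanSpace.proj j : E3 →L[ℝ] ℝ)) y := fun j y =>
    (Complex.ofRealCLM.comp (EuclideanSpace.proj j : E3 →L[ℝ] ℝ)).hasFDerivAt
  have hcd : ∀ j : Fin 3, ∀ y ∈ sphere (0 : E3) 1,
      ContDiffAt ℝ 1 (fun y : E3 => ((y j : ℝ) : ℂ) * f y) y := fun j y hy =>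
    ((Complex.ofRealCLM.comp (EuclideanSpace.proj j : E3 →L[ℝ] ℝ)).contDiff.contDiffAt).mul
      (hf y hy)
  have h : ∑ j, ∫ ω : sphere (0 : E3) 1, fderiv ℝ (fun y : E3 => ((y j : ℝ) : ℂ) * f y) ω
      ((ω : E3) j • EuclideanSpace.single i (1 : ℝ) -
        (ω : E3) i • EuclideanSpace.single j (1 : ℝ)) ∂sphereMeasure = 0 :=
    Finset.sum_eq_zero fun j _ => integral_fderiv_planeRotation (hcd j) j i
  rw [← integral_finsetSum] at h
  · rw [← h]
    refine integral_congr_ae (.of_forall fun ω => ?_)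
    have hω : (ω : E3) 0 ^ 2 + (ω : E3) 1 ^ 2 + (ω : E3) 2 ^ 2 = 1 := by
      have := EuclideanSpace.norm_sq_eq (ω : E3)
      simp only [norm_eq_of_mem_sphere, Real.norm_eq_abs, sq_abs, Fin.sum_univ_three] at this
      linarith
    have hωC : ((ω : E3) 0 : ℂ) ^ 2 + ((ω : E3) 1 : ℂ) ^ 2 + ((ω : E3) 2 : ℂ) ^ 2 = 1 := by
      simpa using congrArg Complex.ofReal hω
    have hdec : (ω : E3) = ∑ j, (ω : E3) j • EuclideanSpace.single j (1 : ℝ) := by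
      ext m
      fin_cases m <;> simp [Fin.sum_univ_three]
    have hd := ((hf ω ω.2).differentiableAt one_ne_zero).hasFDerivAt
    have hωd : fderiv ℝ f ω ω =
        ∑ j, ((ω : E3) j : ℂ) * fderiv ℝ f ω (EuclideanSpace.single j 1) := by
      conv_lhs => enter [2]; rw [hdec]
      simp only [Fin.sum_univ_three, map_add, map_smul, Complex.real_smul]
    have hprod : ∀ j, fderiv ℝ (fun y : E3 => ((y j : ℝ) : ℂ) * f y) ω = _ := fun j =>
      ((hcoord j ω).mul hd).fderiv
    simp only [hprod, hωd, Fin.sum_univ_three]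
    fin_cases i <;> simp [-Complex.real_smul, map_sub, map_smul] <;>
      simp only [Complex.real_smul] <;> grind
  · intro j _
    refine integrable_sphereMeasure ((continuous_fderiv_sphere (hcd j)).clm_apply ?_)
    fun_prop

/-- The Riccati form `t ^ (n + 1) * b n t` of a family `b` of spherical Bessel functions with
`t * b 0 t = f t` and `g = f'`. -/
def riccatiBessel (f g : ℝ → ℂ) : ℕ → ℝ → ℂ
  | 0, t => f t
  | 1, t => f t - t * g t
  | (n + 2), t => (2 * (n : ℂ) + 3) * riccatiBessel f g (n + 1) t - t ^ 2 * riccatiBessel f g n t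

theorem hasDerivAt_riccatiBessel_succ {f g : ℝ → ℂ}
    (hf : ∀ t, HasDerivAt f (g t) t) (hg : ∀ t, HasDerivAt g (-f t) t) (n : ℕ) (t : ℝ) :
    HasDerivAt (riccatiBessel f g (n + 1)) (t * riccatiBessel f g n t) t := by
  have hid : HasDerivAt (fun t : ℝ => (t : ℂ)) 1 t := Complex.ofRealCLM.hasDerivAt
  have hsq : HasDerivAt (fun t : ℝ => (t : ℂ) ^ 2) (2 * t) t := by
    exact (hid.pow 2).congr_deriv (by simp)
  have h0 : HasDerivAt (riccatiBessel f g 1) (t * riccatiBessel f g 0 t) t := by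
    have := (hf t).sub (hid.mul (hg t))
    simp only [riccatiBessel]
    exact this.congr_deriv (by ring)
  have h1 : HasDerivAt (riccatiBessel f g 2) (t * riccatiBessel f g 1 t) t := by
    have := (h0.const_mul (2 * ((0 : ℕ) : ℂ) + 3)).sub (hsq.mul (hf t))
    refine HasDerivAt.congr_deriv (f := riccatiBessel f g 2) this ?_
    simp only [riccatiBessel]
    push_cast
    ring
  induction n using Nat.twoStepInduction with
  | zero => exact h0
  | one => exact h1
  | more n ih1 ih2 =>
    have := (ih2.const_mul (2 * ((n + 1 : ℕ) : ℂ) + 3)).sub (hsq.mul ih1)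
    refine HasDerivAt.congr_deriv (f := riccatiBessel f g (n + 3)) this ?_
    simp only [riccatiBessel]
    push_cast
    ring

theorem exists_hasDerivAt_riccatiBessel {f g : ℝ → ℂ}
    (hf : ∀ t, HasDerivAt f (g t) t) (hg : ∀ t, HasDerivAt g (-f t) t) (n : ℕ) (t : ℝ) :
    ∃ d, HasDerivAt (riccatiBessel f g n) d t ∧
      t * d = (2 * (n : ℂ) + 1) * riccatiBessel f g n t - riccatiBessel f g (n + 1) t := by
  cases n with
  | zero => exact ⟨g t, hf t, by simp [riccatiBessel]⟩
  | succ n =>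
    refine ⟨_, hasDerivAt_riccatiBessel_succ hf hg n t, ?_⟩
    simp only [riccatiBessel]
    push_cast
    ring

/-- `riccatiJ l t = t ^ (l + 1) * j_l(t)`. -/
def riccatiJ : ℕ → ℝ → ℂ := riccatiBessel (fun t => Real.sin t) fun t => Real.cos t

/-- `riccatiH l t = t ^ (l + 1) * h_l(t)`. -/
def riccatiH : ℕ → ℝ → ℂ :=
  riccatiBessel (fun t => Real.sin t - Complex.I * Real.cos t)
    fun t => Real.cos t + Complex.I * Real.sin t

theorem hasDerivAt_sin_ofReal (t : ℝ) :
    HasDerivAt (fun t : ℝ => (Real.sin t : ℂ)) (Real.cos t) t :=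
  (Real.hasDerivAt_sin t).ofReal_comp

theorem hasDerivAt_cos_ofReal (t : ℝ) :
    HasDerivAt (fun t : ℝ => (Real.cos t : ℂ)) (-Real.sin t) t := by
  simpa using (Real.hasDerivAt_cos t).ofReal_comp

theorem hasDerivAt_riccatiJ_succ (n : ℕ) (t : ℝ) :
    HasDerivAt (riccatiJ (n + 1)) (t * riccatiJ n t) t :=
  hasDerivAt_riccatiBessel_succ hasDerivAt_sin_ofReal hasDerivAt_cos_ofReal n t

theorem exists_hasDerivAt_riccatiH (n : ℕ) (t : ℝ) :
    ∃ d, HasDerivAt (riccatiH n) d t ∧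
      t * d = (2 * (n : ℂ) + 1) * riccatiH n t - riccatiH (n + 1) t := by
  refine exists_hasDerivAt_riccatiBessel (fun t => ?_) (fun t => ?_) n t
  · exact ((hasDerivAt_sin_ofReal t).sub
      ((hasDerivAt_cos_ofReal t).const_mul Complex.I)).congr_deriv (by ring)
  · exact ((hasDerivAt_cos_ofReal t).add
      ((hasDerivAt_sin_ofReal t).const_mul Complex.I)).congr_deriv (by ring)

theorem riccatiJ_zero_right (n : ℕ) : riccatiJ n 0 = 0 := by
  unfold riccatiJ
  induction n using Nat.twoStepInduction with
  | zero => simp [riccatiBessel]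
  | one => simp [riccatiBessel]
  | more n ih1 ih2 => rw [riccatiBessel, ih1, ih2]; simp

theorem riccatiJ_eq (n : ℕ) {t : ℝ} (ht : t ≠ 0) :
    riccatiJ n t = t ^ (n + 1) * sphericalBesselJ n t := by
  have htC : (t : ℂ) ≠ 0 := by exact_mod_cast ht
  unfold riccatiJ
  induction n using Nat.twoStepInduction with
  | zero => simp only [riccatiBessel, sphericalBesselJ]; push_cast; field_simp
  | one => simp only [riccatiBessel, sphericalBesselJ]; push_cast; field_simp
  | more n ih1 ih2 =>
    simp only [riccatiBessel, sphericalBesselJ, ih1, ih2]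
    push_cast
    field_simp
    ring

theorem riccatiH_eq (n : ℕ) {t : ℝ} (ht : t ≠ 0) :
    riccatiH n t = t ^ (n + 1) * sphericalHankel n t := by
  have htC : (t : ℂ) ≠ 0 := by exact_mod_cast ht
  unfold riccatiH sphericalHankel
  induction n using Nat.twoStepInduction with
  | zero =>
    simp only [riccatiBessel, sphericalBesselJ, sphericalBesselY]
    push_cast
    field_simp
    ring
  | one =>
    simp only [riccatiBessel, sphericalBesselJ, sphericalBesselY]
    push_cast
    field_simp
    ring
  | more n ih1 ih2 =>
    simp only [riccatiBessel, sphericalBesselJ, sphericalBesselY, ih1, ih2]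
    push_cast
    field_simp
    ring

/-- The function on `ℝ³` defined by a complex polynomial. -/
abbrev polyFun (P : MvPolynomial (Fin 3) ℂ) (y : E3) : ℂ :=
  MvPolynomial.eval (fun i => (y i : ℂ)) P

/-- The `i`-th coordinate as a continuous linear map to `ℂ`. -/
abbrev coordCLM (i : Fin 3) : E3 →L[ℝ] ℂ :=
  Complex.ofRealCLM.comp (EuclideanSpace.proj i : E3 →L[ℝ] ℝ)

theorem polyFun_C (c : ℂ) : polyFun (MvPolynomial.C c) = fun _ => c := by
  funext y
  simp [polyFun]

theorem polyFun_add (p q : MvPolynomial (Fin 3) ℂ) : polyFun (p + q) = polyFun p + polyFun q := by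
  funext y
  simp [polyFun]

theorem polyFun_mul_X (p : MvPolynomial (Fin 3) ℂ) (j : Fin 3) :
    polyFun (p * MvPolynomial.X j) = polyFun p * coordCLM j := by
  funext y
  simp [polyFun]

theorem hasFDerivAt_polyFun (P : MvPolynomial (Fin 3) ℂ) (y : E3) :
    HasFDerivAt (polyFun P) (∑ i, polyFun (MvPolynomial.pderiv i P) y • coordCLM i) y := by
  induction P using MvPolynomial.induction_on with
  | C c =>
    rw [polyFun_C]
    exact (hasFDerivAt_const c y).congr_fderiv (by ext v; simp [polyFun])
  | add p q hp hq =>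
    rw [polyFun_add]
    exact (hp.add hq).congr_fderiv (by ext v; simp [polyFun, add_mul, Finset.sum_add_distrib])
  | mul_X p j hp =>
    rw [polyFun_mul_X]
    refine (hp.mul (coordCLM j).hasFDerivAt).congr_fderiv ?_
    simp only [polyFun, Derivation.leibniz, MvPolynomial.pderiv_X, smul_eq_mul, map_add, map_mul,
      MvPolynomial.eval_X, Fin.sum_univ_three]
    ext v
    fin_cases j <;> simp <;> ring

theorem fderiv_polyFun_single (P : MvPolynomial (Fin 3) ℂ) (y : E3) (i : Fin 3) :
    fderiv ℝ (polyFun P) y (EuclideanSpace.single i 1) = polyFun (MvPolynomial.pderiv i P) y := by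
  rw [(hasFDerivAt_polyFun P y).fderiv]
  fin_cases i <;> simp [Fin.sum_univ_three]

theorem contDiff_polyFun (P : MvPolynomial (Fin 3) ℂ) : ContDiff ℝ 1 (polyFun P) := by
  induction P using MvPolynomial.induction_on with
  | C c =>
    rw [polyFun_C]
    exact contDiff_const
  | add p q hp hq =>
    rw [polyFun_add]
    exact hp.add hq
  | mul_X p j hp =>
    rw [polyFun_mul_X]
    exact hp.mul (coordCLM j).contDiff

theorem eq_zero_of_polyFun_eq_zero {P : MvPolynomial (Fin 3) ℂ} (h : ∀ y, polyFun P y = 0) :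
    P = 0 := by
  refine MvPolynomial.funext_set (fun _ => Set.range ((↑) : ℝ → ℂ)) (fun z hz => ?_)
    (hs := fun _ => Set.infinite_range_of_injective Complex.ofReal_injective)
  choose v hv using fun i => hz i (Set.mem_univ i)
  have := h (WithLp.toLp 2 v)
  simp only [polyFun, hv] at this
  simpa using this

theorem sum_pderiv_pderiv_eq_zero {P : MvPolynomial (Fin 3) ℂ}
    (h : ∀ x : E3, laplacian (polyFun P) x = 0) :
    ∑ i, MvPolynomial.pderiv i (MvPolynomial.pderiv i P) = 0 := by
  refine eq_zero_of_polyFun_eq_zero fun y => ?_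
  rw [← h y, laplacian]
  simp only [fderiv_polyFun_single]
  simp [polyFun]

theorem polyFun_smul {P : MvPolynomial (Fin 3) ℂ} {l : ℕ} (hP : P.IsHomogeneous l) (c : ℝ)
    (y : E3) : polyFun P (c • y) = (c : ℂ) ^ l * polyFun P y := by
  simp only [polyFun, MvPolynomial.eval_eq', Finset.mul_sum]
  refine Finset.sum_congr rfl fun d hd => ?_
  have hl : ∑ i, d i = l := by
    rw [← hP (MvPolynomial.mem_support_iff.1 hd), Finsupp.weight_apply,
      Finsupp.sum_fintype _ _ (by simp)]
    simp
  simp only [PiLp.smul_apply, smul_eq_mul, Complex.ofReal_mul, mul_pow, Finset.prod_mul_distrib,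
    Finset.prod_pow_eq_pow_sum, hl]
  ring

theorem sum_mul_polyFun_pderiv {P : MvPolynomial (Fin 3) ℂ} {l : ℕ} (hP : P.IsHomogeneous l)
    (y : E3) : ∑ i, (y i : ℂ) * polyFun (MvPolynomial.pderiv i P) y = l * polyFun P y := by
  simpa [polyFun] using congrArg (MvPolynomial.eval fun i => (y i : ℂ)) hP.sum_X_mul_pderiv

theorem fderiv_polyFun_self {P : MvPolynomial (Fin 3) ℂ} {l : ℕ} (hP : P.IsHomogeneous l)
    (y : E3) : fderiv ℝ (polyFun P) y y = l * polyFun P y := by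
  rw [(hasFDerivAt_polyFun P y).fderiv, ← sum_mul_polyFun_pderiv hP y]
  simp only [Fin.sum_univ_three]
  simp
  ring

/-- Green's identity on the unit sphere, for a harmonic polynomial written through Euler's
identity. -/
theorem integral_harmonic_mul {P : MvPolynomial (Fin 3) ℂ} {l : ℕ} (hP : P.IsHomogeneous (l + 1))
    (hPh : ∑ i, MvPolynomial.pderiv i (MvPolynomial.pderiv i P) = 0) {u : E3 → ℂ}
    (hu : ∀ y ∈ sphere (0 : E3) 1, ContDiffAt ℝ 1 u y) :
    ∫ ω : sphere (0 : E3) 1, (∑ i, polyFun (MvPolynomial.pderiv i P) ω *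
      fderiv ℝ u ω (EuclideanSpace.single i 1) - (l + 1) * (polyFun P ω * fderiv ℝ u ω ω) -
      (l + 1) * (l + 2) * (polyFun P ω * u ω)) ∂sphereMeasure = 0 := by
  have hcd : ∀ i : Fin 3, ∀ y ∈ sphere (0 : E3) 1,
      ContDiffAt ℝ 1 (polyFun (MvPolynomial.pderiv i P) * u) y := fun i y hy =>
    (contDiff_polyFun _).contDiffAt.mul (hu y hy)
  have huc : Continuous fun ω : sphere (0 : E3) 1 => u ω :=
    continuous_iff_continuousAt.2 fun ω =>
      (hu ω ω.2).continuousAt.comp continuous_subtype_val.continuousAt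
  have h := Finset.sum_eq_zero (s := Finset.univ) fun i _ => integral_tangential_fderiv (hcd i) i
  rw [← integral_finsetSum] at h
  · rw [← h]
    refine integral_congr_ae (.of_forall fun ω => ?_)
    have hd := ((hu ω ω.2).differentiableAt one_ne_zero).hasFDerivAt
    have hprod : ∀ i, fderiv ℝ (polyFun (MvPolynomial.pderiv i P) * u) ω = _ := fun i =>
      (((contDiff_polyFun (MvPolynomial.pderiv i P)).differentiable one_ne_zero
        ω).hasFDerivAt.mul hd).fderiv
    have hself : ∀ i, fderiv ℝ (polyFun (MvPolynomial.pderiv i P)) ω ω =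
        l * polyFun (MvPolynomial.pderiv i P) ω := fun i => fderiv_polyFun_self hP.pderiv ω
    have heuler := sum_mul_polyFun_pderiv hP (ω : E3)
    have hlap : ∑ i, polyFun (MvPolynomial.pderiv i (MvPolynomial.pderiv i P)) ω = 0 := by
      simpa [polyFun] using congrArg (fun p => polyFun p ω) hPh
    simp only [hprod, _root_.add_apply, _root_.smul_apply, smul_eq_mul,
      fderiv_polyFun_single, hself, Pi.mul_apply]
    simp only [Fin.sum_univ_three] at heuler hlap ⊢
    push_cast at heuler
    linear_combination (-u ω) * hlap + (fderiv ℝ u ω ω + (l + 2) * u ω) * heuler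
  · intro i _
    refine integrable_sphereMeasure ?_
    have h1 : Continuous fun ω : sphere (0 : E3) 1 => polyFun (MvPolynomial.pderiv i P) ω :=
      (contDiff_polyFun _).continuous.comp continuous_subtype_val
    have h2 := (continuous_fderiv_sphere (hcd i)).clm_apply
      (continuous_const (y := EuclideanSpace.single i (1 : ℝ)))
    have h3 := (continuous_fderiv_sphere (hcd i)).clm_apply continuous_subtype_val
    have h4 : Continuous fun ω : sphere (0 : E3) 1 => (((ω : E3) i : ℝ) : ℂ) := by fun_prop
    exact (h2.sub (h4.mul h3)).sub ((continuous_const.mul h4).mul (h1.mul huc))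

/-- The unnormalised layer potential at `x`, with kernel `K` and density `P`, on the sphere of
radius `a`. -/
def layerIntegral (K : E3 → ℂ) (P : MvPolynomial (Fin 3) ℂ) (a : ℝ) (x : E3) : ℂ :=
  ∫ ω : sphere (0 : E3) 1, polyFun P ω * K (x - a • (ω : E3)) ∂sphereMeasure

theorem sub_smul_sphere_ne_zero {x : E3} {a : ℝ} (h : |a| < ‖x‖) (ω : sphere (0 : E3) 1) :
    x - a • (ω : E3) ≠ 0 := by
  intro h0
  rw [sub_eq_zero.1 h0, norm_smul, norm_eq_of_mem_sphere, mul_one, Real.norm_eq_abs] at h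
  exact lt_irrefl _ h

/-- The derivative of a layer potential along an affine motion of the point and the radius. -/
theorem hasDerivAt_layerIntegral {K : E3 → ℂ} (hK : ∀ z ≠ 0, ContDiffAt ℝ 1 K z)
    (P : MvPolynomial (Fin 3) ℂ) (x v : E3) (a b t : ℝ) (h : |a + t * b| < ‖x + t • v‖) :
    HasDerivAt (fun t : ℝ => layerIntegral K P (a + t * b) (x + t • v))
      (∫ ω : sphere (0 : E3) 1, polyFun P ω *
        fderiv ℝ K (x + t • v - (a + t * b) • (ω : E3)) (v - b • (ω : E3)) ∂sphereMeasure) t := by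
  have hP : Continuous fun ω : sphere (0 : E3) 1 => polyFun P ω :=
    (contDiff_polyFun P).continuous.comp continuous_subtype_val
  have hopen : IsOpen {t : ℝ | |a + t * b| < ‖x + t • v‖} :=
    isOpen_lt (by fun_prop) (by fun_prop)
  refine hasDerivAt_integral_of_compactSpace (K := sphere (0 : E3) 1)
    (F := fun t ω => polyFun P ω * K (x + t • v - (a + t * b) • (ω : E3)))
    (F' := fun t ω => polyFun P ω *
      fderiv ℝ K (x + t • v - (a + t * b) • (ω : E3)) (v - b • (ω : E3)))
    (hopen.mem_nhds h) ?_ ?_ ?_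
  · intro t ht ω
    have hz : HasDerivAt (fun t : ℝ => x + t • v - (a + t * b) • (ω : E3))
        (v - b • (ω : E3)) t := by
      have h1 := ((hasDerivAt_id t).smul_const v).const_add x
      have h2 := (((hasDerivAt_id t).mul_const b).const_add a).smul_const (ω : E3)
      exact (h1.sub h2).congr_deriv (by simp)
    exact (((hK _ (sub_smul_sphere_ne_zero ht ω)).differentiableAt
      one_ne_zero).hasFDerivAt.comp_hasDerivAt t hz).const_mul _
  · intro t ht
    refine hP.mul (continuous_iff_continuousAt.2 fun ω => ?_)
    exact ContinuousAt.comp (f := fun ω : sphere (0 : E3) 1 => x + t • v - (a + t * b) • (ω : E3))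
      (hK _ (sub_smul_sphere_ne_zero ht ω)).continuousAt (by fun_prop)
  · rintro ⟨t, ω⟩ ⟨ht, -⟩
    refine ContinuousAt.continuousWithinAt ?_
    refine ContinuousAt.mul (f := fun p : ℝ × sphere (0 : E3) 1 => polyFun P p.2)
      (hP.comp continuous_snd).continuousAt ?_
    refine ContinuousAt.clm_apply (f := fun p : ℝ × sphere (0 : E3) 1 =>
      fderiv ℝ K (x + p.1 • v - (a + p.1 * b) • (p.2 : E3))) ?_ (by fun_prop)
    exact ContinuousAt.comp (f := fun p : ℝ × sphere (0 : E3) 1 =>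
      x + p.1 • v - (a + p.1 * b) • (p.2 : E3))
      ((hK _ (sub_smul_sphere_ne_zero ht ω)).continuousAt_fderiv one_ne_zero) (by fun_prop)

/-- The ladder relation between the potentials of a harmonic polynomial and of its partial
derivatives. -/
theorem exists_hasDerivAt_layerIntegral {K : E3 → ℂ} (hK : ∀ z ≠ 0, ContDiffAt ℝ 1 K z)
    {P : MvPolynomial (Fin 3) ℂ} {l : ℕ}
    (hP : P.IsHomogeneous (l + 1))
    (hPh : ∑ i, MvPolynomial.pderiv i (MvPolynomial.pderiv i P) = 0) {x : E3} {a : ℝ}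
    (h : |a| < ‖x‖) :
    ∃ (d : ℂ) (T : Fin 3 → ℂ), HasDerivAt (fun a => layerIntegral K P a x) d a ∧
      (∀ i, HasDerivAt (fun t : ℝ => layerIntegral K (MvPolynomial.pderiv i P) a
        (x + t • EuclideanSpace.single i (1 : ℝ))) (T i) 0) ∧
      (l + 1) * ((l + 2) * layerIntegral K P a x + a * d) = -a * ∑ i, T i := by
  have hd := hasDerivAt_layerIntegral hK P x 0 0 1 a (by simpa using h)
  have hT := fun i => hasDerivAt_layerIntegral hK (MvPolynomial.pderiv i P) x
    (EuclideanSpace.single i (1 : ℝ)) a 0 0 (by simpa using h)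
  simp only [smul_zero, add_zero, zero_add, mul_one, one_smul, zero_sub, map_neg] at hd
  simp only [mul_zero, add_zero, zero_smul, sub_zero] at hT
  refine ⟨_, _, hd, hT, ?_⟩
  have hne : ∀ y ∈ sphere (0 : E3) 1, x - a • y ≠ 0 := fun y hy =>
    sub_smul_sphere_ne_zero h ⟨y, hy⟩
  have hu : ∀ y ∈ sphere (0 : E3) 1, ContDiffAt ℝ 1 (fun y => K (x - a • y)) y := fun y hy =>
    ContDiffAt.comp (f := fun y : E3 => x - a • y) y (hK _ (hne y hy)) (by fun_prop)
  have hfd : ∀ ω : sphere (0 : E3) 1, ∀ v, fderiv ℝ (fun y => K (x - a • y)) ω v =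
      -a * fderiv ℝ K (x - a • (ω : E3)) v := by
    intro ω v
    have h1 : HasFDerivAt (fun y : E3 => x - a • y) (-(a • ContinuousLinearMap.id ℝ E3)) (ω : E3) :=
      ((hasFDerivAt_id (ω : E3)).const_smul a).const_sub x
    have h2 := ((hK _ (hne ω ω.2)).differentiableAt one_ne_zero).hasFDerivAt.comp (ω : E3) h1
    rw [show (fun y => K (x - a • y)) = K ∘ fun y => x - a • y from rfl, h2.fderiv]
    simp
  have hcont : ∀ Q : MvPolynomial (Fin 3) ℂ,
      Continuous fun ω : sphere (0 : E3) 1 => polyFun Q ω := fun Q =>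
    (contDiff_polyFun Q).continuous.comp continuous_subtype_val
  have hKd : Continuous fun ω : sphere (0 : E3) 1 => fderiv ℝ K (x - a • (ω : E3)) :=
    continuous_iff_continuousAt.2 fun ω =>
      ContinuousAt.comp (f := fun ω : sphere (0 : E3) 1 => x - a • (ω : E3))
        ((hK _ (sub_smul_sphere_ne_zero h ω)).continuousAt_fderiv one_ne_zero) (by fun_prop)
  have hKc : Continuous fun ω : sphere (0 : E3) 1 => K (x - a • (ω : E3)) :=
    continuous_iff_continuousAt.2 fun ω =>
      ContinuousAt.comp (f := fun ω : sphere (0 : E3) 1 => x - a • (ω : E3))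
        (hK _ (sub_smul_sphere_ne_zero h ω)).continuousAt (by fun_prop)
  have hgreen := integral_harmonic_mul hP hPh hu
  simp only [hfd] at hgreen
  have hi1 : ∀ i, Integrable (fun ω : sphere (0 : E3) 1 => polyFun (MvPolynomial.pderiv i P) ω *
      fderiv ℝ K (x - a • (ω : E3)) (EuclideanSpace.single i 1)) sphereMeasure := fun i =>
    integrable_sphereMeasure ((hcont _).mul (hKd.clm_apply continuous_const))
  have hi2 : Integrable (fun ω : sphere (0 : E3) 1 => polyFun P ω *
      -fderiv ℝ K (x - a • (ω : E3)) ω) sphereMeasure :=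
    integrable_sphereMeasure ((hcont _).mul (hKd.clm_apply continuous_subtype_val).neg)
  have hi3 : Integrable (fun ω : sphere (0 : E3) 1 => polyFun P ω *
      K (x - a • (ω : E3))) sphereMeasure :=
    integrable_sphereMeasure ((hcont _).mul hKc)
  have hsplit : ∫ ω : sphere (0 : E3) 1, (-(a : ℂ) * (∑ i, polyFun (MvPolynomial.pderiv i P) ω *
      fderiv ℝ K (x - a • (ω : E3)) (EuclideanSpace.single i 1)) -
      (l + 1) * a * (polyFun P ω * -fderiv ℝ K (x - a • (ω : E3)) ω) -
      (l + 1) * (l + 2) * (polyFun P ω * K (x - a • (ω : E3)))) ∂sphereMeasure = 0 := by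
    rw [← hgreen]
    refine integral_congr_ae (.of_forall fun ω => ?_)
    simp only [Fin.sum_univ_three]
    ring
  rw [integral_sub, integral_sub, integral_const_mul, integral_const_mul, integral_const_mul,
    integral_finsetSum] at hsplit
  · rw [layerIntegral]
    linear_combination -hsplit
  · exact fun i _ => hi1 i
  · exact (integrable_finsetSum _ fun i _ => hi1 i).const_mul _
  · exact hi2.const_mul _
  · exact ((integrable_finsetSum _ fun i _ => hi1 i).const_mul _).sub (hi2.const_mul _)
  · exact hi3.const_mul _

/-- Finite measures on a compact interval are determined by their moments. -/
theorem measure_ext_of_moments {μ ν : Measure ℝ} [IsFiniteMeasure μ] [IsFiniteMeasure ν]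
    {a b : ℝ} (hμ : ∀ᵐ t ∂μ, t ∈ Set.Icc a b) (hν : ∀ᵐ t ∂ν, t ∈ Set.Icc a b)
    (h : ∀ n : ℕ, ∫ t, t ^ n ∂μ = ∫ t, t ^ n ∂ν) : μ = ν := by
  have hInt : ∀ (ρ : Measure ℝ) [IsFiniteMeasure ρ], (∀ᵐ t ∂ρ, t ∈ Set.Icc a b) →
      ∀ f : ℝ → ℝ, Continuous f → Integrable f ρ := by
    intro ρ _ hρ f hf
    obtain ⟨C, hC⟩ := isCompact_Icc.exists_bound_of_continuousOn (s := Set.Icc a b) hf.continuousOn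
    exact Integrable.of_bound hf.aestronglyMeasurable C (hρ.mono hC)
  have hpoly : ∀ p : Polynomial ℝ, ∫ t, p.eval t ∂μ = ∫ t, p.eval t ∂ν := by
    intro p
    simp only [Polynomial.eval_eq_sum_range]
    rw [integral_finsetSum _ fun i _ => hInt μ hμ _ (by fun_prop),
      integral_finsetSum _ fun i _ => hInt ν hν _ (by fun_prop)]
    simp only [integral_const_mul, h]
  refine ext_of_forall_integral_eq_of_IsFiniteMeasure fun f => ?_
  set M := μ.real Set.univ + ν.real Set.univ
  have hM : 0 ≤ M := by positivity
  refine eq_of_forall_dist_le fun ε hε => ?_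
  obtain ⟨p, hp⟩ := exists_polynomial_near_of_continuousOn a b f f.continuous.continuousOn
    (ε / (M + 1)) (by positivity)
  have hbound : ∀ (ρ : Measure ℝ) [IsFiniteMeasure ρ], (∀ᵐ t ∂ρ, t ∈ Set.Icc a b) →
      |∫ t, p.eval t ∂ρ - ∫ t, f t ∂ρ| ≤ ε / (M + 1) * ρ.real Set.univ := by
    intro ρ _ hρ
    rw [← integral_sub (hInt ρ hρ _ p.continuous) (hInt ρ hρ _ f.continuous)]
    exact norm_integral_le_of_norm_le_const (f := fun t => p.eval t - f t)
      (hρ.mono fun t ht => (hp t ht).le)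
  have h1 := hbound μ hμ
  have h2 := hbound ν hν
  rw [hpoly p] at h1
  have h3 : ε / (M + 1) * μ.real Set.univ + ε / (M + 1) * ν.real Set.univ ≤ ε := by
    rw [← mul_add, div_mul_eq_mul_div, div_le_iff₀ (by positivity)]
    nlinarith
  rw [Real.dist_eq]
  rw [abs_le] at h1 h2 ⊢
  constructor <;> linarith

theorem sphereMeasure_real_univ : sphereMeasure.real Set.univ = 4 * Real.pi := by
  rw [sphereMeasure, Measure.toSphere_real_apply_univ, measureReal_def,
    EuclideanSpace.volume_ball_fin_three, finrank_euclideanSpace_fin]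
  rw [ENNReal.toReal_mul, ENNReal.toReal_ofReal (by positivity)]
  simp
  ring

theorem integral_inner_pow {ξ : E3} (hξ : ‖ξ‖ = 1) (n : ℕ) :
    ∫ ω : sphere (0 : E3) 1, inner ℝ (ω : E3) ξ ^ n ∂sphereMeasure =
      2 * Real.pi * ∫ t in (-1 : ℝ)..1, t ^ n := by
  rw [integral_pow]
  have hsum : ∀ y z : E3, inner ℝ y z = y 0 * z 0 + y 1 * z 1 + y 2 * z 2 := fun y z => by
    simp [PiLp.inner_apply, Fin.sum_univ_three]
    ring
  have hξ2 : ξ 0 * ξ 0 + ξ 1 * ξ 1 + ξ 2 * ξ 2 = 1 := by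
    rw [← hsum, real_inner_self_eq_norm_sq, hξ, one_pow]
  have hInt : ∀ f : sphere (0 : E3) 1 → ℝ, Continuous f → Integrable f sphereMeasure :=
    fun f hf => hf.integrable_of_hasCompactSupport (HasCompactSupport.of_compactSpace f)
  have key : ∀ (g g' : ℝ → ℝ), Continuous g → Continuous g' → (∀ t, HasDerivAt g (g' t) t) →
      ContDiff ℝ 1 g →
      ∫ ω : sphere (0 : E3) 1, ((1 - inner ℝ (ω : E3) ξ ^ 2) * g' (inner ℝ (ω : E3) ξ) -
        2 * inner ℝ (ω : E3) ξ * g (inner ℝ (ω : E3) ξ)) ∂sphereMeasure = 0 := by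
    intro g g' hg hg' hgd hgc
    have hcd : ∀ y ∈ sphere (0 : E3) 1,
        ContDiffAt ℝ 1 (fun y : E3 => ((g (inner ℝ y ξ) : ℝ) : ℂ)) y := fun y _ =>
      (Complex.ofRealCLM.contDiff.comp
        (hgc.comp (contDiff_id.inner ℝ contDiff_const))).contDiffAt
    have hfd : ∀ y v : E3, fderiv ℝ (fun y : E3 => ((g (inner ℝ y ξ) : ℝ) : ℂ)) y v =
        (g' (inner ℝ y ξ) * inner ℝ v ξ : ℝ) := by
      intro y v
      have h1 : HasFDerivAt (fun y : E3 => inner ℝ y ξ) ((innerSL ℝ).flip ξ) y :=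
        ((innerSL ℝ).flip ξ).hasFDerivAt
      have h2 := (Complex.ofRealCLM.hasFDerivAt).comp y ((hgd _).comp_hasFDerivAt y h1)
      have h3 : HasFDerivAt (fun y : E3 => ((g (inner ℝ y ξ) : ℝ) : ℂ)) _ y := h2
      rw [h3.fderiv]
      simp only [real_inner_comm]
      simp
      exact Or.inl rfl
    have h := fun i => integral_tangential_fderiv hcd i
    simp only [hfd] at h
    have hreal : ∀ i : Fin 3, ∫ ω : sphere (0 : E3) 1, (g' (inner ℝ (ω : E3) ξ) *
        inner ℝ (EuclideanSpace.single i 1) ξ - (ω : E3) i * (g' (inner ℝ (ω : E3) ξ) *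
          inner ℝ (ω : E3) ξ) - 2 * (ω : E3) i * g (inner ℝ (ω : E3) ξ)) ∂sphereMeasure = 0 := by
      intro i
      apply Complex.ofReal_injective
      rw [← integral_complex_ofReal, Complex.ofReal_zero, ← h i]
      refine integral_congr_ae (.of_forall fun ω => ?_)
      push_cast
      rfl
    have hs : ∑ i, ξ i * ∫ ω : sphere (0 : E3) 1, (g' (inner ℝ (ω : E3) ξ) *
        inner ℝ (EuclideanSpace.single i 1) ξ - (ω : E3) i * (g' (inner ℝ (ω : E3) ξ) *
          inner ℝ (ω : E3) ξ) - 2 * (ω : E3) i * g (inner ℝ (ω : E3) ξ)) ∂sphereMeasure = 0 :=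
      Finset.sum_eq_zero fun i _ => by rw [hreal i, mul_zero]
    simp only [← integral_const_mul] at hs
    rw [← integral_finsetSum _ fun i _ => hInt _ (by fun_prop)] at hs
    rw [← hs]
    refine integral_congr_ae (.of_forall fun ω => ?_)
    have hi : ∀ i, inner ℝ (EuclideanSpace.single i (1 : ℝ)) ξ = ξ i := fun i => by
      simp [EuclideanSpace.inner_single_left]
    simp only [Fin.sum_univ_three, hi]
    have hω := hsum ω ξ
    generalize inner ℝ (ω : E3) ξ = t at hω ⊢
    linear_combination (-g' t) * hξ2 + (-g' t * t - 2 * g t) * hω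
  induction n using Nat.twoStepInduction with
  | zero =>
    simp [sphereMeasure_real_univ]
    ring
  | one =>
    have h := key (fun _ => 1) (fun _ => 0) (by fun_prop) (by fun_prop)
      (fun t => hasDerivAt_const t 1) contDiff_const
    simp only [mul_zero, mul_one, zero_sub, integral_neg, integral_const_mul] at h
    simp only [pow_one]
    norm_num
    linarith
  | more n ih _ =>
    have h := key (fun t => t ^ (n + 1)) (fun t => (n + 1) * t ^ n) (by fun_prop) (by fun_prop)
      (fun t => by simpa using hasDerivAt_pow (n + 1) t) (by fun_prop)
    have h2 : ∫ ω : sphere (0 : E3) 1, (((n : ℝ) + 1) * inner ℝ (ω : E3) ξ ^ n -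
        ((n : ℝ) + 3) * inner ℝ (ω : E3) ξ ^ (n + 2)) ∂sphereMeasure = 0 := by
      rw [← h]
      refine integral_congr_ae (.of_forall fun ω => ?_)
      simp only
      ring
    rw [integral_sub (hInt _ (by fun_prop)) (hInt _ (by fun_prop)), integral_const_mul,
      integral_const_mul, ih] at h2
    have hn : (n : ℝ) + 1 ≠ 0 := by positivity
    have hn3 : (n : ℝ) + 3 ≠ 0 := by positivity
    have hn3' : (n : ℝ) + 2 + 1 ≠ 0 := by positivity
    push_cast
    field_simp at h2 ⊢
    simp only [one_pow] at h2 ⊢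
    rw [show (-1 : ℝ) ^ (n + 2 + 1) = (-1) ^ (n + 1) by ring]
    linear_combination -h2

/-- **Archimedes' hat-box theorem**: the projection of the area of the unit sphere to an axis is
uniform. -/
theorem map_inner_sphereMeasure {ξ : E3} (hξ : ‖ξ‖ = 1) :
    sphereMeasure.map (fun ω : sphere (0 : E3) 1 => inner ℝ (ω : E3) ξ) =
      ENNReal.ofReal (2 * Real.pi) • volume.restrict (Set.Ioc (-1 : ℝ) 1) := by
  have hm : Measurable fun ω : sphere (0 : E3) 1 => inner ℝ (ω : E3) ξ :=
    (by fun_prop : Continuous fun ω : sphere (0 : E3) 1 => inner ℝ (ω : E3) ξ).measurable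
  have hfin : IsFiniteMeasure
      (ENNReal.ofReal (2 * Real.pi) • volume.restrict (Set.Ioc (-1 : ℝ) 1)) :=
    Measure.smul_finite _ ENNReal.ofReal_ne_top
  refine measure_ext_of_moments (a := -1) (b := 1) ?_ ?_ fun n => ?_
  · refine (ae_map_iff hm.aemeasurable measurableSet_Icc).2 (.of_forall fun ω => ?_)
    have := abs_real_inner_le_norm (ω : E3) ξ
    rw [hξ, norm_eq_of_mem_sphere, one_mul] at this
    exact abs_le.1 this
  · refine Measure.ae_smul_measure ?_ _
    filter_upwards [ae_restrict_mem measurableSet_Ioc] with t ht using ⟨ht.1.le, ht.2⟩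
  · rw [integral_map hm.aemeasurable (by fun_prop), integral_inner_pow hξ, integral_smul_measure,
      ENNReal.toReal_ofReal (by positivity), intervalIntegral.integral_of_le (by norm_num),
      smul_eq_mul]

theorem integral_inner_sphere {ξ : E3} (hξ : ‖ξ‖ = 1) {g : ℝ → ℂ} (hg : Measurable g) :
    ∫ ω : sphere (0 : E3) 1, g (inner ℝ (ω : E3) ξ) ∂sphereMeasure =
      2 * Real.pi * ∫ t in (-1 : ℝ)..1, g t := by
  have hm : Measurable fun ω : sphere (0 : E3) 1 => inner ℝ (ω : E3) ξ :=
    (by fun_prop : Continuous fun ω : sphere (0 : E3) 1 => inner ℝ (ω : E3) ξ).measurable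
  rw [← integral_map hm.aemeasurable hg.aestronglyMeasurable, map_inner_sphereMeasure hξ,
    integral_smul_measure, ENNReal.toReal_ofReal (by positivity),
    intervalIntegral.integral_of_le (by norm_num), Complex.real_smul]
  push_cast
  rfl

/-- The outgoing fundamental solution of the Helmholtz equation with pole at the origin. -/
def helmholtzKernel (k : ℝ) (z : E3) : ℂ :=
  Complex.exp (Complex.I * k * ‖z‖) / (4 * Real.pi * ‖z‖)

theorem contDiffAt_helmholtzKernel (k : ℝ) (z : E3) (hz : z ≠ 0) :
    ContDiffAt ℝ 1 (helmholtzKernel k) z := by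
  have hn : ContDiffAt ℝ 1 (fun z : E3 => ((‖z‖ : ℝ) : ℂ)) z :=
    Complex.ofRealCLM.contDiff.contDiffAt.comp z (contDiffAt_norm ℝ hz)
  have hne : (4 * Real.pi * (‖z‖ : ℝ) : ℂ) ≠ 0 := by
    have := norm_ne_zero_iff.2 hz
    have := Real.pi_ne_zero
    norm_cast
    positivity
  have : helmholtzKernel k = fun z : E3 =>
      Complex.exp (Complex.I * k * ‖z‖) * (4 * Real.pi * (‖z‖ : ℝ) : ℂ)⁻¹ := rfl
  rw [this]
  exact (contDiffAt_const.mul hn).cexp.mul ((contDiffAt_const.mul hn).inv hne)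

theorem integral_exp_sqrt_div_sqrt {k r a : ℝ} (h : |a| < r) :
    (k * a * r : ℂ) * ∫ t in (-1 : ℝ)..1,
        Complex.exp (Complex.I * k * √(r ^ 2 + a ^ 2 - 2 * r * a * t)) /
          (√(r ^ 2 + a ^ 2 - 2 * r * a * t) : ℝ) =
      2 * Real.sin (k * a) * Complex.exp (Complex.I * k * r) := by
  have hr : 0 < r := (abs_nonneg a).trans_lt h
  obtain ⟨ha1, ha2⟩ := abs_lt.1 h
  have hpos : ∀ t ∈ Set.uIcc (-1 : ℝ) 1, 0 < r ^ 2 + a ^ 2 - 2 * r * a * t := by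
    intro t ht
    rw [Set.uIcc_of_le (by norm_num)] at ht
    have h1 : |t| ≤ 1 := abs_le.2 ht
    have h2 : a * t < r :=
      calc a * t ≤ |a| * |t| := (le_abs_self _).trans_eq (abs_mul a t)
        _ ≤ |a| := mul_le_of_le_one_right (abs_nonneg a) h1
        _ < r := h
    have h3 : 0 < (r - a * t) ^ 2 := pow_pos (sub_pos.2 h2) 2
    have h4 : 0 ≤ a ^ 2 * (1 - t ^ 2) :=
      mul_nonneg (sq_nonneg a) (sub_nonneg.2 ((sq_le_one_iff_abs_le_one t).2 h1))
    linarith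
  have hderiv : ∀ t ∈ Set.uIcc (-1 : ℝ) 1, HasDerivAt
      (fun t : ℝ => Complex.exp (Complex.I * k * √(r ^ 2 + a ^ 2 - 2 * r * a * t)))
      (-(Complex.I * k * (a * r)) *
        (Complex.exp (Complex.I * k * √(r ^ 2 + a ^ 2 - 2 * r * a * t)) /
          (√(r ^ 2 + a ^ 2 - 2 * r * a * t) : ℝ))) t := by
    intro t ht
    have hq : HasDerivAt (fun t : ℝ => r ^ 2 + a ^ 2 - 2 * r * a * t) (-(2 * r * a)) t := by
      simpa using ((hasDerivAt_id t).const_mul (2 * r * a)).const_sub (r ^ 2 + a ^ 2)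
    have hs := ((hq.sqrt (hpos t ht).ne').ofReal_comp.const_mul (Complex.I * k)).cexp
    refine hs.congr_deriv ?_
    have : ((√(r ^ 2 + a ^ 2 - 2 * r * a * t) : ℝ) : ℂ) ≠ 0 := by
      exact_mod_cast (Real.sqrt_pos.2 (hpos t ht)).ne'
    push_cast
    field_simp
  have hcont : ContinuousOn (fun t : ℝ => -(Complex.I * k * (a * r)) *
        (Complex.exp (Complex.I * k * √(r ^ 2 + a ^ 2 - 2 * r * a * t)) /
          (√(r ^ 2 + a ^ 2 - 2 * r * a * t) : ℝ))) (Set.uIcc (-1) 1) := by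
    refine ContinuousOn.mul continuousOn_const (ContinuousOn.div (by fun_prop) (by fun_prop) ?_)
    intro t ht
    exact_mod_cast (Real.sqrt_pos.2 (hpos t ht)).ne'
  have hF := intervalIntegral.integral_eq_sub_of_hasDerivAt hderiv hcont.intervalIntegrable
  rw [intervalIntegral.integral_const_mul,
    show r ^ 2 + a ^ 2 - 2 * r * a * 1 = (r - a) ^ 2 by ring,
    show r ^ 2 + a ^ 2 - 2 * r * a * (-1) = (r + a) ^ 2 by ring,
    Real.sqrt_sq (by linarith), Real.sqrt_sq (by linarith)] at hF
  have hsin : Complex.exp (Complex.I * k * (r - a : ℝ)) - Complex.exp (Complex.I * k * (r + a : ℝ)) =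
      -(2 * Complex.I * Real.sin (k * a) * Complex.exp (Complex.I * k * r)) := by
    rw [Complex.ofReal_sin, Complex.sin]
    push_cast
    rw [show Complex.I * k * (r - a : ℂ) = Complex.I * k * r + -(k * a) * Complex.I by ring,
      show Complex.I * k * (r + a : ℂ) = Complex.I * k * r + (k * a) * Complex.I by ring,
      Complex.exp_add, Complex.exp_add]
    linear_combination (Complex.exp (-(k * a) * Complex.I) - Complex.exp (k * a * Complex.I)) *
      Complex.exp (Complex.I * k * r) * Complex.I_sq
  rw [hsin] at hF
  exact mul_left_cancel₀ Complex.I_ne_zero (by linear_combination -hF)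

theorem integral_helmholtzKernel {k a : ℝ} {x : E3} (h : |a| < ‖x‖) :
    (k * a * ‖x‖ : ℂ) * ∫ ω : sphere (0 : E3) 1, helmholtzKernel k (x - a • (ω : E3))
        ∂sphereMeasure =
      Real.sin (k * a) * Complex.exp (Complex.I * k * ‖x‖) := by
  have hr : 0 < ‖x‖ := (abs_nonneg a).trans_lt h
  have hξ : ‖‖x‖⁻¹ • x‖ = 1 := norm_smul_inv_norm (𝕜 := ℝ) (norm_pos_iff.1 hr)
  have hnorm : ∀ ω : sphere (0 : E3) 1, ‖x - a • (ω : E3)‖ =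
      √(‖x‖ ^ 2 + a ^ 2 - 2 * ‖x‖ * a * inner ℝ (ω : E3) (‖x‖⁻¹ • x)) := by
    intro ω
    rw [← Real.sqrt_sq (norm_nonneg (x - a • (ω : E3))), norm_sub_sq_real, inner_smul_right,
      inner_smul_right, norm_smul, norm_eq_of_mem_sphere, real_inner_comm, Real.norm_eq_abs,
      mul_one, sq_abs]
    congr 1
    field_simp
    ring
  have hg := integral_inner_sphere hξ (g := fun t : ℝ =>
    Complex.exp (Complex.I * k * √(‖x‖ ^ 2 + a ^ 2 - 2 * ‖x‖ * a * t)) /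
      (4 * Real.pi * (√(‖x‖ ^ 2 + a ^ 2 - 2 * ‖x‖ * a * t) : ℝ))) (by fun_prop)
  simp only [helmholtzKernel, hnorm]
  rw [hg]
  have hsplit : ∀ t : ℝ, Complex.exp (Complex.I * k * √(‖x‖ ^ 2 + a ^ 2 - 2 * ‖x‖ * a * t)) /
      (4 * Real.pi * (√(‖x‖ ^ 2 + a ^ 2 - 2 * ‖x‖ * a * t) : ℝ)) = (4 * Real.pi : ℂ)⁻¹ *
      (Complex.exp (Complex.I * k * √(‖x‖ ^ 2 + a ^ 2 - 2 * ‖x‖ * a * t)) /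
        (√(‖x‖ ^ 2 + a ^ 2 - 2 * ‖x‖ * a * t) : ℝ)) := fun t => by
    rw [div_mul_eq_div_div, div_eq_mul_inv _ (4 * Real.pi : ℂ)]
    ring
  simp only [hsplit]
  rw [intervalIntegral.integral_const_mul]
  have hI := integral_exp_sqrt_div_sqrt (k := k) h
  have hpi : (Real.pi : ℂ) ≠ 0 := by exact_mod_cast Real.pi_ne_zero
  have h2pi : (2 * Real.pi : ℂ) * (4 * Real.pi : ℂ)⁻¹ = 2⁻¹ := by
    field_simp
    norm_num
  rw [← mul_assoc (2 * Real.pi : ℂ), h2pi]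
  linear_combination 2⁻¹ * hI

theorem hasDerivAt_norm_add_smul_single {x : E3} (hx : x ≠ 0) (i : Fin 3) :
    HasDerivAt (fun t : ℝ => ‖x + t • EuclideanSpace.single i (1 : ℝ)‖) (x i / ‖x‖) 0 := by
  have hl : HasDerivAt (fun t : ℝ => x + t • EuclideanSpace.single i (1 : ℝ))
      (EuclideanSpace.single i (1 : ℝ)) 0 := by
    simpa using ((hasDerivAt_id (0 : ℝ)).smul_const (EuclideanSpace.single i (1 : ℝ))).const_add x
  have h := hl.norm_sq.sqrt (by simpa using hx)
  simp only [Real.sqrt_sq (norm_nonneg _)] at h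
  refine h.congr_deriv ?_
  simp [EuclideanSpace.inner_single_right]
  field_simp

theorem pderiv_comm (P : MvPolynomial (Fin 3) ℂ) (i j : Fin 3) :
    MvPolynomial.pderiv i (MvPolynomial.pderiv j P) =
      MvPolynomial.pderiv j (MvPolynomial.pderiv i P) := by
  have h : ⁅MvPolynomial.pderiv (R := ℂ) i, MvPolynomial.pderiv (R := ℂ) j⁆ = 0 := by
    ext m
    simp [Derivation.commutator_apply, MvPolynomial.pderiv_X, Pi.single_apply]
    split_ifs <;> simp
  have := DFunLike.congr_fun h P
  rwa [Derivation.commutator_apply, Derivation.zero_apply, sub_eq_zero] at this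

/-- The single layer potential of a solid harmonic, in Riccati form. -/
theorem layerIntegral_helmholtzKernel {k : ℝ} (hk : k ≠ 0) (l : ℕ) :
    ∀ {P : MvPolynomial (Fin 3) ℂ}, P.IsHomogeneous l →
      ∑ i, MvPolynomial.pderiv i (MvPolynomial.pderiv i P) = 0 →
      ∀ {x : E3} {a : ℝ}, |a| < ‖x‖ →
        (k : ℂ) ^ (2 * l + 1) * a ^ (l + 1) * layerIntegral (helmholtzKernel k) P a x =
          Complex.I * riccatiJ l (k * a) *
            (riccatiH l (k * ‖x‖) * ((‖x‖ : ℂ) ^ (2 * l + 1))⁻¹) * polyFun P x := by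
  induction l with
  | zero =>
    intro P hP _ x a h
    have hr : (‖x‖ : ℂ) ≠ 0 := by exact_mod_cast ((abs_nonneg a).trans_lt h).ne'
    obtain rfl | ha := eq_or_ne a 0
    · simp [riccatiJ_zero_right]
    obtain ⟨c, rfl⟩ : ∃ c, P = MvPolynomial.C c :=
      ⟨_, MvPolynomial.totalDegree_eq_zero_iff_eq_C.1 (Nat.le_zero.1 hP.totalDegree_le)⟩
    have hI := integral_helmholtzKernel (k := k) h
    have hC : ∀ y, polyFun (MvPolynomial.C c) y = c := congrFun (polyFun_C c)
    simp only [layerIntegral, hC, integral_const_mul, riccatiJ, riccatiH, riccatiBessel]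
    have hexp : Complex.exp (Complex.I * k * ‖x‖) =
        Real.cos (k * ‖x‖) + Complex.I * Real.sin (k * ‖x‖) := by
      rw [show Complex.I * k * ‖x‖ = (k * ‖x‖ : ℝ) * Complex.I by push_cast; ring,
        Complex.exp_mul_I]
      push_cast
      ring
    rw [hexp] at hI
    field_simp
    linear_combination c * hI + c * Real.sin (k * a) * Real.cos (k * ‖x‖) * Complex.I_sq
  | succ l ih =>
    intro P hP hPh x a h
    set r := ‖x‖ with hr_def
    have hr : 0 < r := (abs_nonneg a).trans_lt h
    have hrc : (r : ℂ) ≠ 0 := by exact_mod_cast hr.ne'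
    have hkc : (k : ℂ) ≠ 0 := by exact_mod_cast hk
    have hl : (l + 1 : ℂ) ≠ 0 := by exact_mod_cast l.succ_ne_zero
    have hx : x ≠ 0 := norm_pos_iff.1 hr
    obtain ⟨dH, hdH, hdH'⟩ := exists_hasDerivAt_riccatiH l (k * r)
    have hQ : ∀ i, (MvPolynomial.pderiv i P).IsHomogeneous l := fun i => hP.pderiv
    have hQh : ∀ i, ∑ j, MvPolynomial.pderiv j (MvPolynomial.pderiv j
        (MvPolynomial.pderiv i P)) = 0 := by
      intro i
      rw [← map_zero (MvPolynomial.pderiv (R := ℂ) i), ← hPh, map_sum]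
      refine Finset.sum_congr rfl fun j _ => ?_
      rw [pderiv_comm P j i, pderiv_comm _ j i]
    have hradial : ∀ i, HasDerivAt (fun t : ℝ =>
        riccatiH l (k * ‖x + t • EuclideanSpace.single i (1 : ℝ)‖) *
          ((‖x + t • EuclideanSpace.single i (1 : ℝ)‖ : ℂ) ^ (2 * l + 1))⁻¹)
        (-(x i * riccatiH (l + 1) (k * r) / (r : ℂ) ^ (2 * l + 3))) 0 := by
      intro i
      have hn := hasDerivAt_norm_add_smul_single hx i
      have h1 : HasDerivAt (fun t : ℝ =>
          riccatiH l (k * ‖x + t • EuclideanSpace.single i (1 : ℝ)‖)) _ 0 :=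
        HasDerivAt.scomp (g₁ := riccatiH l)
          (h := fun t : ℝ => k * ‖x + t • EuclideanSpace.single i (1 : ℝ)‖)
          (0 : ℝ) (by simpa using hdH) (hn.const_mul k)
      have h2 := (hn.ofReal_comp.pow (2 * l + 1)).inv (by simpa using hx)
      refine (h1.mul h2).congr_deriv ?_
      simp only [Pi.inv_apply, Pi.pow_apply, zero_smul, add_zero, ← hr_def, Complex.real_smul]
      have hdH'' : dH = ((2 * l + 1) * riccatiH l (k * r) - riccatiH (l + 1) (k * r)) / (k * r) := by
        rw [← hdH']
        push_cast
        field_simp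
      rw [hdH'']
      push_cast
      field_simp
      ring
    have hmain : ∀ b ∈ Set.Ioo (-r) r, HasDerivAt (fun b : ℝ =>
        (k : ℂ) ^ (2 * l + 3) * ((b : ℂ) ^ (l + 2) * layerIntegral (helmholtzKernel k) P b x) -
          Complex.I * riccatiH (l + 1) (k * r) * ((r : ℂ) ^ (2 * l + 3))⁻¹ * polyFun P x *
            riccatiJ (l + 1) (k * b)) 0 b := by
      intro b hb
      have hb' : |b| < ‖x‖ := abs_lt.2 hb
      obtain ⟨d, T, hd, hT, hdT⟩ :=
        exists_hasDerivAt_layerIntegral (contDiffAt_helmholtzKernel k) hP hPh hb'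
      have hTi : ∀ i, (k : ℂ) ^ (2 * l + 1) * b ^ (l + 1) * T i =
          Complex.I * riccatiJ l (k * b) *
            (-(x i * riccatiH (l + 1) (k * r) / (r : ℂ) ^ (2 * l + 3)) *
              polyFun (MvPolynomial.pderiv i P) x +
            riccatiH l (k * r) * ((r : ℂ) ^ (2 * l + 1))⁻¹ *
              polyFun (MvPolynomial.pderiv i (MvPolynomial.pderiv i P)) x) := by
        intro i
        have hlhs := (hT i).const_mul ((k : ℂ) ^ (2 * l + 1) * b ^ (l + 1))
        have hline : HasDerivAt (fun t : ℝ => x + t • EuclideanSpace.single i (1 : ℝ))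
            (EuclideanSpace.single i (1 : ℝ)) 0 := by
          simpa using
            ((hasDerivAt_id (0 : ℝ)).smul_const (EuclideanSpace.single i (1 : ℝ))).const_add x
        have hpoly : HasDerivAt (fun t : ℝ => polyFun (MvPolynomial.pderiv i P)
            (x + t • EuclideanSpace.single i (1 : ℝ)))
            (polyFun (MvPolynomial.pderiv i (MvPolynomial.pderiv i P)) x) 0 := by
          rw [← fderiv_polyFun_single]
          refine HasFDerivAt.comp_hasDerivAt (l := polyFun (MvPolynomial.pderiv i P)) (0 : ℝ) ?_ hline
          simpa using (hasFDerivAt_polyFun (MvPolynomial.pderiv i P) x).differentiableAt.hasFDerivAt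
        have hrhs := ((hradial i).mul hpoly).const_mul (Complex.I * riccatiJ l (k * b))
        have hev : ∀ᶠ t : ℝ in 𝓝 0, |b| < ‖x + t • EuclideanSpace.single i (1 : ℝ)‖ :=
          (isOpen_lt (by fun_prop) (by fun_prop) :
            IsOpen {t : ℝ | |b| < ‖x + t • EuclideanSpace.single i (1 : ℝ)‖}).mem_nhds
              (by simpa using hb')
        have heq := (hrhs.congr_of_eventuallyEq (hev.mono fun t ht => by
          simpa [mul_assoc] using ih (hQ i) (hQh i) ht)).unique hlhs
        rw [← heq]
        simp [← hr_def]
      have hsum : (k : ℂ) ^ (2 * l + 1) * b ^ (l + 1) * ∑ i, T i =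
          -(Complex.I * riccatiJ l (k * b) * (riccatiH (l + 1) (k * r) / (r : ℂ) ^ (2 * l + 3)) *
            ((l + 1) * polyFun P x)) := by
        have hE := sum_mul_polyFun_pderiv hP x
        have hL : ∑ i, polyFun (MvPolynomial.pderiv i (MvPolynomial.pderiv i P)) x = 0 := by
          have := congrArg (fun p => polyFun p x) hPh
          simpa [polyFun] using this
        simp only [Fin.sum_univ_three] at hE hL ⊢
        push_cast at hE
        linear_combination hTi 0 + hTi 1 + hTi 2 -
          Complex.I * riccatiJ l (k * b) * (riccatiH (l + 1) (k * r) / (r : ℂ) ^ (2 * l + 3)) * hE +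
          Complex.I * riccatiJ l (k * b) * riccatiH l (k * r) * ((r : ℂ) ^ (2 * l + 1))⁻¹ * hL
      have hid : HasDerivAt (fun b : ℝ => (b : ℂ)) 1 b := Complex.ofRealCLM.hasDerivAt
      have hJ : HasDerivAt (fun b : ℝ => riccatiJ (l + 1) (k * b)) _ b :=
        HasDerivAt.scomp (h := fun b : ℝ => k * b) b (hasDerivAt_riccatiJ_succ l (k * b))
          ((hasDerivAt_id b).const_mul k)
      refine ((((hid.pow (l + 2)).mul hd).const_mul ((k : ℂ) ^ (2 * l + 3))).sub
        (hJ.const_mul _)).congr_deriv ?_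
      apply mul_left_cancel₀ hl
      simp only [Pi.pow_apply, Complex.real_smul]
      push_cast
      linear_combination (k : ℂ) ^ (2 * l + 3) * b ^ (l + 1) * hdT - k ^ 2 * b * hsum
    have hconst := isOpen_Ioo.is_const_of_deriv_eq_zero isPreconnected_Ioo
      (fun b hb => (hmain b hb).differentiableAt.differentiableWithinAt)
      (fun b hb => (hmain b hb).deriv) (abs_lt.1 h) (show (0 : ℝ) ∈ Set.Ioo (-r) r by simp [hr])
    simp only [Complex.ofReal_zero, mul_zero, riccatiJ_zero_right, ne_eq, Nat.add_eq_zero_iff,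
      OfNat.ofNat_ne_zero, and_false, not_false_eq_true, zero_pow, zero_mul, sub_zero] at hconst
    simp only [show 2 * (l + 1) + 1 = 2 * l + 3 by ring, show l + 1 + 1 = l + 2 by ring]
    linear_combination hconst

end
/-- single layer potential of a spherical harmonic density. -/
theorem single_layer_of_spherical_harmonic (a' k : ℝ) (ha : 0 < a') (hk : 0 < k)
    (l : ℕ) (Y : E3 → ℂ) (hY : IsSphericalHarmonic l Y) (x : E3) (hx : a' < ‖x‖) :
    slPotential k a' Y x =
      Complex.I * (k : ℂ) * (a' : ℂ) ^ 2 * (sphericalBesselJ l (k * a') : ℂ) *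
        sphericalHankel l (k * ‖x‖) * Y (‖x‖⁻¹ • x) := by
  obtain ⟨P, hP, hlap, hYP⟩ := hY
  have hr : 0 < ‖x‖ := ha.trans hx
  have hrc : (‖x‖ : ℂ) ≠ 0 := by exact_mod_cast hr.ne'
  have hac : (a' : ℂ) ≠ 0 := by exact_mod_cast ha.ne'
  have hkc : (k : ℂ) ≠ 0 := by exact_mod_cast hk.ne'
  have hmain := layerIntegral_helmholtzKernel hk.ne' l hP (sum_pderiv_pderiv_eq_zero hlap)
    (x := x) (a := a') (by rwa [abs_of_pos ha])
  have hsl : slPotential k a' Y x = a' ^ 2 • layerIntegral (helmholtzKernel k) P a' x := by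
    rw [slPotential, sphereIntegral, layerIntegral]
    congr 1
    refine integral_congr_ae (.of_forall fun ω => ?_)
    have hω : ‖(ω : E3)‖ = 1 := norm_eq_of_mem_sphere ω
    simp only [norm_smul, hω, Real.norm_eq_abs, abs_of_pos ha, mul_one]
    rw [inv_smul_smul₀ ha.ne', hYP _ hω]
    rfl
  have hYx : Y (‖x‖⁻¹ • x) = (‖x‖⁻¹ : ℝ) ^ l * polyFun P x := by
    rw [hYP _ (by simpa using norm_smul_inv_norm (𝕜 := ℝ) (norm_pos_iff.1 hr)), ← polyFun_smul hP]
  rw [riccatiJ_eq l (mul_pos hk ha).ne', riccatiH_eq l (mul_pos hk hr).ne'] at hmain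
  rw [hsl, hYx, Complex.real_smul]
  have hpow : (k : ℂ) ^ (2 * l + 1) * a' ^ (l + 1) ≠ 0 := by positivity
  apply mul_left_cancel₀ hpow
  rw [mul_left_comm, hmain]
  push_cast
  rw [inv_pow]
  field_simp
  ring
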